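/- There exist universal constants 0 < c₁ ≤ c₂ such that for every d ≥ 1, every T > 0, and every pair of tones (v, f), (v*, f*) ∈ ℂ × ℝ^d, the quantity err := T^{-d} · ∫_{[−T/2, T/2]^d} |v·e^{2πi·f^⊤τ} − v*·e^{2πi·f*^⊤τ}|² dτ satisfies c₁·( |v − v*|² + |v*|²·min{1, T²·‖f − f*‖₂²} ) ≤ err ≤ c₂·( |v − v*|² + |v*|²·min{1, T²·‖f − f*‖₂²} ). -/

import Mathlib

open Real MeasureTheory

/-- The pure tone `τ ↦ v · e^{2πi f·τ}`. -/
noncomputable def tone {d : ℕ} (v : ℂ) (f : Fin d → ℝ) (τ : Fin d → ℝ) : ℂ :=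
  v * Complex.exp (2 * (π : ℂ) * Complex.I * ((∑ r, f r * τ r : ℝ) : ℂ))

/-- The box `[-T/2, T/2]^d`. -/
noncomputable def box (d : ℕ) (T : ℝ) : Set (Fin d → ℝ) :=
  Set.univ.pi fun _ => Set.Icc (-T / 2) (T / 2)

/-- Euclidean (`ℓ₂`) norm of a vector in `ℝ^d`. -/
noncomputable def l2norm {d : ℕ} (x : Fin d → ℝ) : ℝ := Real.sqrt (∑ r, (x r) ^ 2)

/-! ### Bounds on `sinc` -/

lemma one_sub_sq_div_six_le_sinc (x : ℝ) : 1 - x ^ 2 / 6 ≤ sinc x := by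
  wlog hx : 0 ≤ x generalizing x
  · simpa using this (-x) (by linarith)
  rcases hx.eq_or_lt with rfl | hx
  · simp
  · rw [sinc_of_ne_zero hx.ne', le_div_iff₀ hx]
    linarith [sin_gt_sub_cube hx]

lemma abs_sinc_le_half {x : ℝ} (hx : 2 ≤ |x|) : |sinc x| ≤ 1 / 2 := by
  have h0 : x ≠ 0 := by rintro rfl; norm_num at hx
  rw [sinc_of_ne_zero h0, abs_div, div_le_iff₀ (by linarith)]
  linarith [abs_sin_le_one x]

lemma neg_half_le_sinc (x : ℝ) : -(1 / 2) ≤ sinc x := by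
  rcases le_total 2 |x| with hx | hx
  · exact (abs_le.mp (abs_sinc_le_half hx)).1
  · have h : x ^ 2 ≤ 2 ^ 2 := sq_le_sq' (abs_le.mp hx).1 (abs_le.mp hx).2
    linarith [one_sub_sq_div_six_le_sinc x]

lemma sinc_eq_sinc_half_mul_cos_half (x : ℝ) : sinc x = sinc (x / 2) * cos (x / 2) := by
  rcases eq_or_ne x 0 with rfl | hx
  · simp
  · rw [sinc_of_ne_zero hx, sinc_of_ne_zero (by positivity)]
    nth_rewrite 1 [show x = 2 * (x / 2) by ring]
    rw [sin_two_mul]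
    field_simp

lemma abs_sinc_pi_mul_le (y : ℝ) : |sinc (π * y)| ≤ 1 - min 1 (y ^ 2) / 2 := by
  rcases le_total 2 |π * y| with hx | hx
  · linarith [abs_sinc_le_half hx, min_le_left 1 (y ^ 2)]
  · have hπ := pi_gt_three
    have hhalf : |π * y / 2| ≤ 1 := by
      rw [abs_div, abs_two]; linarith
    have hcos : 0 ≤ cos (π * y / 2) :=
      cos_nonneg_of_neg_pi_div_two_le_of_le (by linarith [(abs_le.mp hhalf).1])
        (by linarith [(abs_le.mp hhalf).2])
    have hquad := cos_le_one_sub_mul_cos_sq (hhalf.trans (by linarith))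
    have hsq : 2 / π ^ 2 * (π * y / 2) ^ 2 = y ^ 2 / 2 := by field_simp
    rw [sinc_eq_sinc_half_mul_cos_half, abs_mul, abs_of_nonneg hcos]
    calc |sinc (π * y / 2)| * cos (π * y / 2) ≤ 1 * cos (π * y / 2) := by
          gcongr; exact abs_sinc_le_one _
      _ ≤ 1 - min 1 (y ^ 2) / 2 := by linarith [min_le_right 1 (y ^ 2)]

/-! ### Bounds on products -/

lemma neg_half_le_prod_and_prod_le_one {ι : Type*} (s : Finset ι) (a : ι → ℝ)
    (ha : ∀ i ∈ s, -(1 / 2) ≤ a i ∧ a i ≤ 1) :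
    -(1 / 2) ≤ ∏ i ∈ s, a i ∧ ∏ i ∈ s, a i ≤ 1 := by
  refine Finset.prod_induction a (fun x ↦ -(1 / 2) ≤ x ∧ x ≤ 1) ?_ (by norm_num) ha
  rintro x y ⟨hx, hx'⟩ ⟨hy, hy'⟩
  constructor <;> nlinarith

lemma one_sub_prod_le_sum_one_sub {ι : Type*} (s : Finset ι) (a : ι → ℝ)
    (ha : ∀ i ∈ s, -(1 / 2) ≤ a i ∧ a i ≤ 1) :
    1 - ∏ i ∈ s, a i ≤ ∑ i ∈ s, (1 - a i) := by
  classical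
  induction s using Finset.induction_on with
  | empty => simp
  | insert i s hi ih =>
    have hs : ∀ j ∈ s, -(1 / 2) ≤ a j ∧ a j ≤ 1 :=
      fun j hj ↦ ha j (Finset.mem_insert_of_mem hj)
    have hprod := (neg_half_le_prod_and_prod_le_one s a hs).2
    have hai := (ha i (Finset.mem_insert_self i s)).2
    rw [Finset.prod_insert hi, Finset.sum_insert hi]
    nlinarith [ih hs]

lemma min_one_sum_le_sum_min_one {ι : Type*} (s : Finset ι) (a : ι → ℝ) (ha : ∀ i, 0 ≤ a i) :
    min 1 (∑ i ∈ s, a i) ≤ ∑ i ∈ s, min 1 (a i) := by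
  have hmin : ∀ i ∈ s, 0 ≤ min 1 (a i) := fun i _ ↦ le_min zero_le_one (ha i)
  by_cases h : ∃ i ∈ s, 1 ≤ a i
  · obtain ⟨i, hi, h1⟩ := h
    calc min 1 (∑ i ∈ s, a i) ≤ 1 := min_le_left _ _
      _ = min 1 (a i) := (min_eq_left h1).symm
      _ ≤ ∑ i ∈ s, min 1 (a i) := Finset.single_le_sum hmin hi
  · push Not at h
    refine (min_le_right _ _).trans (Finset.sum_le_sum fun i hi ↦ ?_)
    rw [min_eq_right (h i hi).le]

lemma prod_sinc_pi_mul_le {ι : Type*} (s : Finset ι) (y : ι → ℝ) :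
    ∏ i ∈ s, sinc (π * y i) ≤ 1 - min 1 (∑ i ∈ s, y i ^ 2) / 3 := by
  set M := min 1 (∑ i ∈ s, y i ^ 2)
  have hM0 : 0 ≤ M := le_min zero_le_one (Finset.sum_nonneg fun i _ ↦ sq_nonneg _)
  have hM1 : M ≤ 1 := min_le_left _ _
  calc ∏ i ∈ s, sinc (π * y i) ≤ ∏ i ∈ s, |sinc (π * y i)| := by
        rw [← Finset.abs_prod]; exact le_abs_self _
    _ ≤ ∏ i ∈ s, exp (-(min 1 (y i ^ 2) / 2)) := by
        refine Finset.prod_le_prod (fun i _ ↦ abs_nonneg _) fun i _ ↦ ?_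
        exact (abs_sinc_pi_mul_le (y i)).trans (one_sub_le_exp_neg _)
    _ = exp (-((∑ i ∈ s, min 1 (y i ^ 2)) / 2)) := by
        rw [← exp_sum, Finset.sum_neg_distrib, Finset.sum_div]
    _ ≤ exp (-(M / 2)) := by
        gcongr
        exact min_one_sum_le_sum_min_one s _ fun i ↦ sq_nonneg _
    _ ≤ (1 + M / 2)⁻¹ := by
        rw [exp_neg]
        gcongr
        linarith [add_one_le_exp (M / 2)]
    _ ≤ 1 - M / 3 := by
        rw [inv_le_iff_one_le_mul₀ (by linarith)]
        nlinarith

lemma neg_half_le_prod_sinc {ι : Type*} (s : Finset ι) (x : ι → ℝ) :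
    -(1 / 2) ≤ ∏ i ∈ s, sinc (x i) :=
  (neg_half_le_prod_and_prod_le_one s _ fun _ _ ↦ ⟨neg_half_le_sinc _, sinc_le_one _⟩).1

lemma one_sub_prod_sinc_pi_mul_le {ι : Type*} (s : Finset ι) (y : ι → ℝ) :
    1 - ∏ i ∈ s, sinc (π * y i) ≤ 2 * min 1 (∑ i ∈ s, y i ^ 2) := by
  rw [mul_min_of_nonneg _ _ zero_le_two]
  refine le_min (by linarith [neg_half_le_prod_sinc s fun i ↦ π * y i]) ?_
  refine (one_sub_prod_le_sum_one_sub s _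
    fun i _ ↦ ⟨neg_half_le_sinc _, sinc_le_one _⟩).trans ?_
  rw [Finset.mul_sum]
  refine Finset.sum_le_sum fun i _ ↦ ?_
  have hπ : π ^ 2 ≤ 12 := by nlinarith [pi_lt_d2, pi_pos]
  nlinarith [one_sub_sq_div_six_le_sinc (π * y i), sq_nonneg (y i)]

/-! ### The error as an explicit quadratic form -/

lemma integral_Icc_exp_two_pi_mul (T : ℝ) (hT : 0 < T) (a : ℝ) :
    ∫ t in Set.Icc (-T / 2) (T / 2), Complex.exp (2 * π * Complex.I * ((a * t : ℝ) : ℂ)) =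
      ((T * sinc (π * (T * a)) : ℝ) : ℂ) := by
  rw [integral_Icc_eq_integral_Ioc, ← intervalIntegral.integral_of_le (by linarith)]
  rcases eq_or_ne a 0 with rfl | ha
  · simp
    ring
  · have hc : 2 * π * a ≠ 0 := by positivity
    have h := intervalIntegral.integral_comp_mul_left (a := -T / 2) (b := T / 2)
      (fun t : ℝ ↦ Complex.exp (t * Complex.I)) hc
    rw [show 2 * π * a * (-T / 2) = -(π * (T * a)) by ring,
      show 2 * π * a * (T / 2) = π * (T * a) by ring, integral_exp_mul_I_eq_sinc] at h
    convert h using 1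
    · congr 1
      ext t
      push_cast
      ring_nf
    · rw [Complex.real_smul]
      push_cast
      have : (π : ℂ) ≠ 0 := by exact_mod_cast pi_ne_zero
      have : (a : ℂ) ≠ 0 := by exact_mod_cast ha
      field_simp

lemma integral_box_exp {d : ℕ} (T : ℝ) (hT : 0 < T) (g : Fin d → ℝ) :
    ∫ τ in box d T, Complex.exp (2 * π * Complex.I * ((∑ r, g r * τ r : ℝ) : ℂ)) =
      ((T ^ d * ∏ r, sinc (π * (T * g r)) : ℝ) : ℂ) := by
  have hexp (τ : Fin d → ℝ) : Complex.exp (2 * π * Complex.I * ((∑ r, g r * τ r : ℝ) : ℂ)) =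
      ∏ r, Complex.exp (2 * π * Complex.I * ((g r * τ r : ℝ) : ℂ)) := by
    rw [← Complex.exp_sum, Complex.ofReal_sum, Finset.mul_sum]
  simp_rw [hexp]
  rw [box, volume_pi, Measure.restrict_pi_pi,
    integral_fintype_prod_eq_prod
      (fun r (t : ℝ) ↦ Complex.exp (2 * π * Complex.I * ((g r * t : ℝ) : ℂ)))]
  simp_rw [integral_Icc_exp_two_pi_mul T hT]
  rw [← Complex.ofReal_prod, Finset.prod_mul_distrib]
  simp

lemma volume_real_box (d : ℕ) (T : ℝ) (hT : 0 < T) : volume.real (box d T) = T ^ d := by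
  rw [Measure.real, box, volume_pi, Measure.pi_pi]
  simp [show T / 2 - -T / 2 = T by ring, hT.le]

lemma isCompact_box (d : ℕ) (T : ℝ) : IsCompact (box d T) :=
  isCompact_univ_pi fun _ ↦ isCompact_Icc

lemma norm_tone_sub_tone_sq {d : ℕ} (v vs : ℂ) (f fs τ : Fin d → ℝ) :
    ‖tone v f τ - tone vs fs τ‖ ^ 2 = ‖v‖ ^ 2 + ‖vs‖ ^ 2 -
      2 * (v * starRingEnd ℂ vs *
        Complex.exp (2 * π * Complex.I * ((∑ r, (f - fs) r * τ r : ℝ) : ℂ))).re := by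
  have hnorm (x : ℝ) : ‖Complex.exp (2 * π * Complex.I * (x : ℂ))‖ = 1 := by
    rw [show 2 * π * Complex.I * (x : ℂ) = ((2 * π * x : ℝ) : ℂ) * Complex.I by push_cast; ring]
    exact Complex.norm_exp_ofReal_mul_I _
  have hconj (x y : ℝ) : Complex.exp (2 * π * Complex.I * (x : ℂ)) *
      starRingEnd ℂ (Complex.exp (2 * π * Complex.I * (y : ℂ))) =
      Complex.exp (2 * π * Complex.I * ((x - y : ℝ) : ℂ)) := by
    rw [← Complex.exp_conj, ← Complex.exp_add]
    congr 1
    simp only [map_mul, Complex.conj_ofReal, Complex.conj_I, Complex.conj_ofNat,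
      Complex.ofReal_sub]
    ring
  have hsum : ∑ r, (f - fs) r * τ r = ∑ r, f r * τ r - ∑ r, fs r * τ r := by
    simp [sub_mul]
  rw [hsum, ← hconj, Complex.sq_norm, Complex.normSq_sub, ← Complex.sq_norm, ← Complex.sq_norm]
  simp only [tone, norm_mul, hnorm, mul_one, map_mul]
  congr 3
  ring

lemma mean_norm_tone_sub_tone_sq {d : ℕ} (T : ℝ) (hT : 0 < T) (v vs : ℂ) (f fs : Fin d → ℝ) :
    (T ^ d)⁻¹ * (∫ τ in box d T, ‖tone v f τ - tone vs fs τ‖ ^ 2) =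
      (1 + ∏ r, sinc (π * (T * (f - fs) r))) / 2 * ‖v - vs‖ ^ 2 +
        (1 - ∏ r, sinc (π * (T * (f - fs) r))) / 2 * ‖v + vs‖ ^ 2 := by
  have hint : IntegrableOn (fun τ : Fin d → ℝ ↦ v * starRingEnd ℂ vs *
      Complex.exp (2 * π * Complex.I * ((∑ r, (f - fs) r * τ r : ℝ) : ℂ))) (box d T) :=
    ContinuousOn.integrableOn_compact (isCompact_box d T) (by fun_prop)
  have hre := integral_re (𝕜 := ℂ) hint
  rw [integral_const_mul, integral_box_exp T hT] at hre
  simp only [RCLike.re_eq_complex_re, Complex.re_mul_ofReal] at hre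
  have hint_re := hint.re
  simp only [RCLike.re_eq_complex_re] at hint_re
  have hconst : IntegrableOn (fun _ : Fin d → ℝ ↦ ‖v‖ ^ 2 + ‖vs‖ ^ 2) (box d T) :=
    continuousOn_const.integrableOn_compact (isCompact_box d T)
  simp_rw [norm_tone_sub_tone_sq]
  rw [integral_sub hconst (hint_re.const_mul 2), integral_const_mul, hre, setIntegral_const,
    volume_real_box d T hT, smul_eq_mul]
  have hT' : T ^ d ≠ 0 := by positivity
  field_simp
  simp only [Complex.sq_norm, Complex.normSq_apply, Complex.mul_re, Complex.conj_re,
    Complex.conj_im, Complex.sub_re, Complex.sub_im, Complex.add_re, Complex.add_im]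
  ring

lemma sq_mul_l2norm_sq {d : ℕ} (T : ℝ) (g : Fin d → ℝ) :
    T ^ 2 * l2norm g ^ 2 = ∑ r, (T * g r) ^ 2 := by
  rw [l2norm, sq_sqrt (Finset.sum_nonneg fun r _ ↦ sq_nonneg _), Finset.mul_sum]
  simp_rw [mul_pow]

theorem stmt_16 : ∃ c₁ c₂ : ℝ, 0 < c₁ ∧ c₁ ≤ c₂ ∧
    ∀ d : ℕ, 1 ≤ d → ∀ T : ℝ, 0 < T → ∀ (v vs : ℂ) (f fs : Fin d → ℝ),
      c₁ * (‖v - vs‖ ^ 2 +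
          ‖vs‖ ^ 2 * min 1 (T ^ 2 * l2norm (f - fs) ^ 2)) ≤
        (T ^ d)⁻¹ * (∫ τ in box d T, ‖tone v f τ - tone vs fs τ‖ ^ 2) ∧
      (T ^ d)⁻¹ * (∫ τ in box d T, ‖tone v f τ - tone vs fs τ‖ ^ 2) ≤
        c₂ * (‖v - vs‖ ^ 2 +
          ‖vs‖ ^ 2 * min 1 (T ^ 2 * l2norm (f - fs) ^ 2)) := by
  refine ⟨1 / 12, 8, by norm_num, by norm_num, fun d _ T hT v vs f fs ↦ ?_⟩
  rw [mean_norm_tone_sub_tone_sq T hT, sq_mul_l2norm_sq]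
  have hneg := neg_half_le_prod_sinc Finset.univ fun r ↦ π * (T * (f - fs) r)
  have hupper := prod_sinc_pi_mul_le Finset.univ fun r ↦ T * (f - fs) r
  have hlower := one_sub_prod_sinc_pi_mul_le Finset.univ fun r ↦ T * (f - fs) r
  have hM0 : 0 ≤ min 1 (∑ r, (T * (f - fs) r) ^ 2) :=
    le_min zero_le_one (Finset.sum_nonneg fun r _ ↦ sq_nonneg _)
  have hM1 : min 1 (∑ r, (T * (f - fs) r) ^ 2) ≤ 1 := min_le_left _ _
  set S := ∏ r, sinc (π * (T * (f - fs) r))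
  set M := min 1 (∑ r, (T * (f - fs) r) ^ 2)
  have hD : 0 ≤ ‖v - vs‖ ^ 2 := sq_nonneg _
  have hV : 0 ≤ ‖vs‖ ^ 2 := sq_nonneg _
  have hP : 0 ≤ ‖v + vs‖ ^ 2 := sq_nonneg _
  have hPlow : 2 * ‖vs‖ ^ 2 - ‖v - vs‖ ^ 2 ≤ ‖v + vs‖ ^ 2 := by
    simp only [Complex.sq_norm, Complex.normSq_apply, Complex.sub_re, Complex.sub_im,
      Complex.add_re, Complex.add_im]
    nlinarith [sq_nonneg v.re, sq_nonneg v.im]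
  have hPup : ‖v + vs‖ ^ 2 ≤ 2 * ‖v - vs‖ ^ 2 + 8 * ‖vs‖ ^ 2 := by
    simp only [Complex.sq_norm, Complex.normSq_apply, Complex.sub_re, Complex.sub_im,
      Complex.add_re, Complex.add_im]
    nlinarith [sq_nonneg (v.re - 3 * vs.re), sq_nonneg (v.im - 3 * vs.im)]
  generalize ‖v - vs‖ ^ 2 = D at *
  generalize ‖v + vs‖ ^ 2 = P at *
  generalize ‖vs‖ ^ 2 = V at *
  constructor
  · calc 1 / 12 * (D + V * M) ≤ 1 / 4 * D + M / 6 * (2 * V - D) := by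
          nlinarith [mul_nonneg hV hM0, mul_le_mul_of_nonneg_right hM1 hD]
      _ ≤ 1 / 4 * D + M / 6 * P := by gcongr
      _ ≤ (1 + S) / 2 * D + (1 - S) / 2 * P :=
          add_le_add (mul_le_mul_of_nonneg_right (by linarith) hD)
            (mul_le_mul_of_nonneg_right (by linarith) hP)
  · calc (1 + S) / 2 * D + (1 - S) / 2 * P ≤ 1 * D + M * P := by gcongr <;> linarith
      _ ≤ 1 * D + M * (2 * D + 8 * V) := by gcongr
      _ ≤ 8 * (D + V * M) := by nlinarith [mul_le_mul_of_nonneg_right hM1 hD]
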